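/- Let G be a minimal counterexample. Then G contains no 4-vertex in U that is incident to four 2-threads. -/

import Mathlib

open SimpleGraph

noncomputable def edgeCount {V : Type*} (G : SimpleGraph V) : ℕ := Nat.card G.edgeSet

noncomputable def deg {V : Type*} (G : SimpleGraph V) (v : V) : ℕ := Nat.card (G.neighborSet v)

def TwoIndependent {V : Type*} (G : SimpleGraph V) (S : Set V) : Prop :=
  ∀ u ∈ S, ∀ v ∈ S, u ≠ v → ¬ G.Adj u v ∧ ∀ w, ¬ (G.Adj u w ∧ G.Adj w v)

def IsIFPartition {V : Type*} (G : SimpleGraph V) (A B : Set V) : Prop :=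
  A ∪ B = Set.univ ∧ Disjoint A B ∧ TwoIndependent G A ∧ (G.induce B).IsAcyclic

def IsAssignment {V : Type*} (I F U : Set V) : Prop :=
  I ∪ F ∪ U = Set.univ ∧ Disjoint I F ∧ Disjoint I U ∧ Disjoint F U

noncomputable def rho {V : Type*} (G : SimpleGraph V) (I F U : Set V) (H : G.Subgraph) : ℤ :=
  (H.verts ∩ I).ncard + 4 * (H.verts ∩ F).ncard + 5 * (H.verts ∩ U).ncard
    - 4 * Nat.card H.edgeSet

noncomputable def rhoSet {V : Type*} (G : SimpleGraph V) (I F U : Set V) (S : Set V) : ℤ :=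
  (S ∩ I).ncard + 4 * (S ∩ F).ncard + 5 * (S ∩ U).ncard - 4 * edgeCount (G.induce S)

def IsCounterexample {V : Type*} [Fintype V] (G : SimpleGraph V) (I F U : Set V) : Prop :=
  IsAssignment I F U ∧
  (∀ H : G.Subgraph, H.verts.Nonempty → 0 < rho G I F U H) ∧
  ¬ ∃ A B : Set V, IsIFPartition G A B ∧ I ⊆ A ∧ F ⊆ B

def IsMinCounterexample {V : Type*} [Fintype V] (G : SimpleGraph V) (I F U : Set V) : Prop :=
  IsCounterexample G I F U ∧
  ∀ (n : ℕ) (G' : SimpleGraph (Fin n)) (I' F' U' : Set (Fin n)),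
    IsCounterexample G' I' F' U' →
    Fintype.card V + edgeCount G ≤ n + edgeCount G'

def IsThread {V : Type*} (G : SimpleGraph V) (I F U : Set V) (p : List V) : Prop :=
  p ≠ [] ∧ p.Nodup ∧ p.Chain' G.Adj ∧ (∀ v ∈ p, v ∈ U ∧ deg G v = 2) ∧
  (∀ w, w ∉ p → (∃ a ∈ p, G.Adj a w) → 3 ≤ deg G w ∨ w ∈ I ∪ F)

def BordersThread {V : Type*} (G : SimpleGraph V) (p : List V) (w : V) : Prop :=
  w ∉ p ∧ ∃ a ∈ p, G.Adj a w

def IsStarForest {V : Type*} (H : SimpleGraph V) : Prop :=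
  H.IsAcyclic ∧ ∀ a b c d : V, H.Adj a b → H.Adj b c → H.Adj c d → a = c ∨ b = d

def IsStarColoring {V : Type*} {k : ℕ} (G : SimpleGraph V) (c : V → Fin k) : Prop :=
  (∀ u v, G.Adj u v → c u ≠ c v) ∧
  ∀ i j : Fin k, IsStarForest (G.induce {v | c v = i ∨ c v = j})

def StarColorable {V : Type*} (G : SimpleGraph V) (k : ℕ) : Prop :=
  ∃ c : V → Fin k, IsStarColoring G c

def MadLt {V : Type*} (G : SimpleGraph V) (q : ℚ) : Prop :=
  ∀ H : G.Subgraph, H.verts.Nonempty →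
    (2 * (Nat.card H.edgeSet : ℚ)) / (H.verts.ncard : ℚ) < q

theorem deg_two_aux {V : Type*} [Finite V] (G : SimpleGraph V) {w a b c : V} (h : deg G w = 2)
    (ha : G.Adj w a) (hb : G.Adj w b) (hc : G.Adj w c) : a = b ∨ a = c ∨ b = c := by
  have h' : (G.neighborSet w).ncard = 2 := h
  obtain ⟨x, y, -, hxy⟩ := Set.ncard_eq_two.mp h'
  have h1 : a ∈ G.neighborSet w := ha
  have h2 : b ∈ G.neighborSet w := hb
  have h3 : c ∈ G.neighborSet w := hc
  rw [hxy] at h1 h2 h3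
  simp only [Set.mem_insert_iff, Set.mem_singleton_iff] at h1 h2 h3
  grind

theorem cycle_two_nbrs {V : Type*} (G : SimpleGraph V) {r : V} (c : G.Walk r r)
    (hc : c.IsCycle) {x : V} (hx : x ∈ c.support) :
    ∃ y z, y ≠ z ∧ G.Adj x y ∧ G.Adj x z ∧ y ∈ c.support ∧ z ∈ c.support := by
  have h := hc.ncard_neighborSet_toSubgraph_eq_two hx
  obtain ⟨y, z, hyz, he⟩ := Set.ncard_eq_two.mp h
  have hy : y ∈ c.toSubgraph.neighborSet x := by rw [he]; simp
  have hz : z ∈ c.toSubgraph.neighborSet x := by rw [he]; simp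
  rw [Subgraph.mem_neighborSet] at hy hz
  refine ⟨y, z, hyz, hy.adj_sub, hz.adj_sub, ?_, ?_⟩
  · exact c.mem_verts_toSubgraph.mp hy.snd_mem
  · exact c.mem_verts_toSubgraph.mp hz.snd_mem

theorem rho_map_aux {V W : Type*} [Finite V] [Finite W] (G : SimpleGraph V) (I F U : Set V)
    (f : W ↪ V) (H : (G.comap f).Subgraph) :
    rho (G.comap f) (f ⁻¹' I) (f ⁻¹' F) (f ⁻¹' U) H
      = rho G I F U (H.map (SimpleGraph.Embedding.comap f G).toHom) := by
  have key : ∀ S : Set V, ((H.map (SimpleGraph.Embedding.comap f G).toHom).verts ∩ S).ncard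
      = (H.verts ∩ f ⁻¹' S).ncard := by
    intro S
    have : (H.map (SimpleGraph.Embedding.comap f G).toHom).verts ∩ S
        = f '' (H.verts ∩ f ⁻¹' S) := by
      rw [Set.image_inter_preimage]; rfl
    rw [this, Set.ncard_image_of_injective _ f.injective]
  have ke : Nat.card (H.map (SimpleGraph.Embedding.comap f G).toHom).edgeSet
      = Nat.card H.edgeSet := by
    rw [Subgraph.edgeSet_map]
    exact Set.ncard_image_of_injective _ (Sym2.map.injective f.injective)
  unfold rho
  rw [key, key, key, ke]

/-- Minimality: deleting a nonempty set of vertices leaves a graph with a partition. -/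
theorem exists_partition_sub {V : Type*} [Fintype V] (G : SimpleGraph V)
    (I F U : Set V) (hmin : IsMinCounterexample G I F U) (S : Set V) (v : V) (hv : v ∈ S) :
    ∃ (n : ℕ) (f : Fin n ↪ V) (A B : Set (Fin n)), Set.range f = Sᶜ ∧
      IsIFPartition (G.comap f) A B ∧ f ⁻¹' I ⊆ A ∧ f ⁻¹' F ⊆ B := by
  classical
  obtain ⟨⟨⟨hun, h1, h2, h3⟩, hpot, -⟩, hm⟩ := hmin
  let e := (Fintype.equivFin (Sᶜ : Set V)).symm
  let f : Fin (Fintype.card (Sᶜ : Set V)) ↪ V := e.toEmbedding.trans (Function.Embedding.subtype _)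
  have hr : Set.range f = Sᶜ := by
    ext x
    constructor
    · rintro ⟨i, rfl⟩
      exact (e i).2
    · intro hx
      exact ⟨e.symm ⟨x, hx⟩, by simp [f]⟩
  by_contra hno
  have hcex : IsCounterexample (G.comap f) (f ⁻¹' I) (f ⁻¹' F) (f ⁻¹' U) := by
    refine ⟨⟨?_, h1.preimage f, h2.preimage f, h3.preimage f⟩, ?_, ?_⟩
    · rw [← Set.preimage_union, ← Set.preimage_union, hun, Set.preimage_univ]
    · intro H hH
      rw [rho_map_aux]
      exact hpot _ (hH.image _)
    · rintro ⟨A, B, hp, ha, hb⟩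
      exact hno ⟨_, f, A, B, hr, hp, ha, hb⟩
  have := hm _ _ _ _ _ hcex
  have hlt : Fintype.card (Sᶜ : Set V) < Fintype.card V :=
    Fintype.card_subtype_lt (x := v) (by simpa using hv)
  have hle : edgeCount (G.comap f) ≤ edgeCount G :=
    Nat.card_le_card_of_injective _
      (SimpleGraph.Embedding.comap f G).mapEdgeSet.injective
  omega

/-- (C3) A minimal counterexample contains no 4-vertex in `U` incident to four 2-threads
(threads incident to `v` are counted with multiplicity: every edge at `v` leads into a
2-thread not containing `v`). -/
theorem no_four_vertex_with_four_two_threads {V : Type*} [Fintype V] (G : SimpleGraph V)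
    (I F U : Set V) (hmin : IsMinCounterexample G I F U) :
    ¬ ∃ v ∈ U, deg G v = 4 ∧
      ∀ u, G.Adj v u → ∃ p : List V, IsThread G I F U p ∧ p.length = 2 ∧ u ∈ p ∧ v ∉ p := by
  classical
  rintro ⟨v, hvU, -, hth⟩
  have hN : ∀ u, G.Adj v u → u ∈ U ∧ deg G u = 2 := by
    intro u hu
    obtain ⟨p, hp, -, hup, -⟩ := hth u hu
    exact hp.2.2.2.1 u hup
  have hN2 : ∀ u w, G.Adj v u → G.Adj u w → w ≠ v → w ∈ U ∧ deg G w = 2 := by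
    intro u w hu hw hwv
    obtain ⟨p, hp, hl, hup, hvp⟩ := hth u hu
    obtain ⟨a, b, rfl⟩ := List.length_eq_two.mp hl
    obtain ⟨-, -, hch, hall, -⟩ := hp
    have hab : G.Adj a b := by simpa [List.Chain'] using hch
    have hdu := (hN u hu).2
    simp only [List.mem_cons, List.not_mem_nil, or_false, not_or] at hup hvp
    rcases hup with rfl | rfl
    · rcases deg_two_aux G hdu hu.symm hw hab with h | h | h
      · exact absurd h.symm hwv
      · exact absurd h hvp.2
      · subst h; exact hall _ (by simp)
    · rcases deg_two_aux G hdu hu.symm hw hab.symm with h | h | h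
      · exact absurd h.symm hwv
      · exact absurd h hvp.1
      · subst h; exact hall _ (by simp)
  let S : Set V := {x | x = v ∨ G.Adj v x ∨ ∃ u, G.Adj v u ∧ G.Adj u x}
  have hvS : v ∈ S := Or.inl rfl
  have hSU : S ⊆ U := by
    rintro x (rfl | h | ⟨u, hu, hx⟩)
    · exact hvU
    · exact (hN x h).1
    · by_cases hxv : x = v
      · rw [hxv]; exact hvU
      · exact (hN2 u x hu hx hxv).1
  obtain ⟨n, f, A, B, hr, ⟨hAB, hdis, hind, hacy⟩, hIA, hFB⟩ :=
    exists_partition_sub G I F U hmin S v hvS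
  have hfS : ∀ i, f i ∉ S := fun i => by
    have : f i ∈ Set.range f := ⟨i, rfl⟩
    rwa [hr] at this
  have hnS : ∀ x, x ∉ S → ∃ i, f i = x := fun x hx => by
    have : x ∈ Set.range f := by rw [hr]; exact hx
    exact this
  obtain ⟨⟨⟨hun, h1, h2, h3⟩, -, hnp⟩, -⟩ := hmin
  apply hnp
  refine ⟨f '' A ∪ {v}, f '' B ∪ (S \ {v}), ⟨?_, ?_, ?_, ?_⟩, ?_, ?_⟩
  · ext x
    simp only [Set.mem_univ, iff_true]
    by_cases hx : x ∈ S
    · by_cases hxv : x = v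
      · exact Or.inl (Or.inr hxv)
      · exact Or.inr (Or.inr ⟨hx, hxv⟩)
    · obtain ⟨i, rfl⟩ := hnS x hx
      have : i ∈ A ∪ B := by rw [hAB]; trivial
      rcases this with h | h
      · exact Or.inl (Or.inl ⟨i, h, rfl⟩)
      · exact Or.inr (Or.inl ⟨i, h, rfl⟩)
  · rw [Set.disjoint_left]
    rintro x (⟨i, hi, rfl⟩ | hx) (⟨j, hj, hij⟩ | ⟨hx1, hx2⟩)
    · rw [f.injective hij] at hj
      exact Set.disjoint_left.mp hdis hi hj
    · exact hfS i hx1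
    · rw [Set.mem_singleton_iff] at hx
      subst hx; rw [← hij] at hvS; exact hfS j hvS
    · exact hx2 hx
  · rintro a (⟨i, hi, rfl⟩ | ha) b (⟨j, hj, rfl⟩ | hb) hab
    · obtain ⟨p, q⟩ := hind i hi j hj (fun h => hab (by rw [h]))
      refine ⟨p, ?_⟩
      rintro w ⟨hw1, hw2⟩
      by_cases hw : w ∈ S
      · rcases hw with rfl | h | ⟨u, hu, hx⟩
        · exact hfS j (Or.inr (Or.inl hw2))
        · exact hfS j (Or.inr (Or.inr ⟨w, h, hw2⟩))
        · by_cases hwv : w = v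
          · subst hwv; exact hfS j (Or.inr (Or.inl hw2))
          · have huS : u ∈ S := Or.inr (Or.inl hu)
            rcases deg_two_aux G (hN2 u w hu hx hwv).2 hx.symm hw1.symm hw2 with h | h | h
            · rw [h] at huS; exact hfS _ huS
            · rw [h] at huS; exact hfS _ huS
            · exact hab h
      · obtain ⟨k, rfl⟩ := hnS w hw
        exact q k ⟨hw1, hw2⟩
    · rw [Set.mem_singleton_iff] at hb
      subst hb
      exact ⟨fun h => hfS i (Or.inr (Or.inl h.symm)),
        fun w h => hfS i (Or.inr (Or.inr ⟨w, h.2.symm, h.1.symm⟩))⟩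
    · rw [Set.mem_singleton_iff] at ha
      subst ha
      exact ⟨fun h => hfS j (Or.inr (Or.inl h)),
        fun w h => hfS j (Or.inr (Or.inr ⟨w, h.1, h.2⟩))⟩
    · rw [Set.mem_singleton_iff] at ha hb
      exact absurd (ha.trans hb.symm) hab
  · intro r c hc
    let g := SimpleGraph.Embedding.induce (G := G) (f '' B ∪ (S \ {v}))
    have hc1 : (c.map g.toHom).IsCycle := hc.map g.injective
    have hsup : ∀ x ∈ (c.map g.toHom).support, x ∈ f '' B ∪ (S \ {v}) := by
      intro x hx
      rw [Walk.support_map, List.mem_map] at hx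
      obtain ⟨y, -, rfl⟩ := hx
      exact y.2
    generalize hd : c.map g.toHom = d at hc1 hsup
    have hv : v ∉ d.support := fun h => by
      rcases hsup v h with ⟨i, -, hi⟩ | h'
      · rw [← hi] at hvS; exact hfS i hvS
      · exact h'.2 rfl
    have hu : ∀ u, G.Adj v u → u ∉ d.support := fun u huv h => by
      obtain ⟨y, z, hyz, hy, hz, hys, hzs⟩ := cycle_two_nbrs G d hc1 h
      rcases deg_two_aux G (hN u huv).2 huv.symm hy hz with h | h | h
      · exact hv (h ▸ hys)
      · exact hv (h ▸ hzs)
      · exact hyz h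
    have hw : ∀ x ∈ S, x ∉ d.support := by
      rintro x (rfl | h | ⟨u, huv, hx⟩) hxs
      · exact hv hxs
      · exact hu x h hxs
      · have hxv : x ≠ v := fun h => hv (h ▸ hxs)
        obtain ⟨y, z, hyz, hy, hz, hys, hzs⟩ := cycle_two_nbrs G d hc1 hxs
        rcases deg_two_aux G (hN2 u x huv hx hxv).2 hx.symm hy hz with h | h | h
        · exact hu u huv (h ▸ hys)
        · exact hu u huv (h ▸ hzs)
        · exact hyz h
    have hB : ∀ x ∈ d.support, x ∈ f '' B := fun x hx => by
      rcases hsup x hx with h | h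
      · exact h
      · exact absurd hx (hw x h.1)
    have hac : (G.induce (f '' B)).IsAcyclic := by
      choose k hkB hk using fun x : (f '' B) => x.2
      let φ : G.induce (f '' B) →g (G.comap f).induce B :=
        { toFun := fun x => ⟨k x, hkB x⟩
          map_rel' := by
            intro a b hab
            change G.Adj (f (k a)) (f (k b))
            rw [hk, hk]
            exact hab }
      refine hacy.comap φ ?_
      intro a b hab
      have : k a = k b := congrArg Subtype.val hab
      exact Subtype.ext (by rw [← hk a, ← hk b, this])
    refine hac (d.induce _ hB) ?_
    refine (Walk.isCycle_map_iff_of_injective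
      (f := (SimpleGraph.Embedding.induce (G := G) (f '' B)).toHom)
      (SimpleGraph.Embedding.induce (G := G) (f '' B)).injective).mp ?_
    have := Walk.map_induce d hB
    rw [← this] at hc1
    exact hc1
  · intro x hx
    have hxS : x ∉ S := fun h => Set.disjoint_left.mp h2 hx (hSU h)
    obtain ⟨i, rfl⟩ := hnS x hxS
    exact Or.inl ⟨i, hIA hx, rfl⟩
  · intro x hx
    have hxS : x ∉ S := fun h => Set.disjoint_left.mp h3 hx (hSU h)
    obtain ⟨i, rfl⟩ := hnS x hxS
    exact Or.inl ⟨i, hFB hx, rfl⟩
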